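/- arXiv:2008.10208 — 3 statements merged into one kernel-verified Lean document; each statement's English description precedes it below -/
import Mathlib

section
/- Every global minimizer x* = (α, A⁽¹⁾, …, A⁽ᵛ⁾, S) of the objective f over the feasible set G (i.e., with the constraint S ≥ 0 removed) satisfies S ≥ 0 entrywise; that is, x* ∈ G₊. -/
/-- The objective function `f(α, A⁽¹⁾, …, A⁽ᵛ⁾, S)` of the consistent graph
learning problem, with `B i i = β` and `B i l = γ` for `i ≠ l`. -/
noncomputable def objf (n v : ℕ) (W : Fin v → Matrix (Fin n) (Fin n) ℝ)
    (lam : Fin v → ℝ) (β γ : ℝ)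
    (α : Fin v → ℝ) (A : Fin v → Matrix (Fin n) (Fin n) ℝ)
    (S : Matrix (Fin n) (Fin n) ℝ) : ℝ :=
  (∑ i, lam i * ∑ j, ∑ k, (α i * A i j k - S j k) ^ 2)
    + ∑ i, ∑ l, (if i = l then β else γ) * lam i * lam l * α i * α l *
        ∑ j, ∑ k, (W i j k - A i j k) * (W l j k - A l j k)

/-- Feasibility of `(α, A⁽¹⁾, …, A⁽ᵛ⁾)`: `α` lies in the simplex `G₀`
and each `A⁽ⁱ⁾` satisfies `0 ≤ A⁽ⁱ⁾ ≤ W⁽ⁱ⁾` entrywise (the sets `Gᵢ`). -/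
def feasible (n v : ℕ) (W : Fin v → Matrix (Fin n) (Fin n) ℝ)
    (α : Fin v → ℝ) (A : Fin v → Matrix (Fin n) (Fin n) ℝ) : Prop :=
  (∀ i, 0 ≤ α i) ∧ (∑ i, α i) = 1 ∧
    (∀ i j k, 0 ≤ A i j k ∧ A i j k ≤ W i j k)

theorem sq_sub_max_zero_lt {a s : ℝ} (ha : 0 ≤ a) (hs : s < 0) :
    (a - max s 0) ^ 2 < (a - s) ^ 2 := by
  rw [max_eq_right hs.le]
  nlinarith [mul_nonneg ha (neg_nonneg.2 hs.le), mul_pos_of_neg_of_neg hs hs]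

theorem sq_sub_max_zero_le {a : ℝ} (ha : 0 ≤ a) (s : ℝ) :
    (a - max s 0) ^ 2 ≤ (a - s) ^ 2 := by
  rcases le_or_gt 0 s with hs | hs
  · rw [max_eq_left hs]
  · exact (sq_sub_max_zero_lt ha hs).le

/-- Every global minimizer of `f` over `G` (no sign constraint on `S`)
satisfies `S ≥ 0` entrywise, i.e. it lies in `G₊`. -/
theorem every_minimizer_has_nonneg_S (n v : ℕ) (hn : 0 < n) (hv : 0 < v)
    (W : Fin v → Matrix (Fin n) (Fin n) ℝ) (hW : ∀ i j k, 0 ≤ W i j k)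
    (lam : Fin v → ℝ) (hlam : ∀ i, 0 < lam i) (β γ : ℝ)
    (α : Fin v → ℝ) (A : Fin v → Matrix (Fin n) (Fin n) ℝ)
    (S : Matrix (Fin n) (Fin n) ℝ)
    (hfeas : feasible n v W α A)
    (hmin : ∀ (α' : Fin v → ℝ) (A' : Fin v → Matrix (Fin n) (Fin n) ℝ)
      (S' : Matrix (Fin n) (Fin n) ℝ), feasible n v W α' A' →
      objf n v W lam β γ α A S ≤ objf n v W lam β γ α' A' S') :
    ∀ j k, 0 ≤ S j k := by
  intro j₀ k₀
  by_contra! hneg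
  have ha : ∀ i j k, 0 ≤ α i * A i j k := fun i j k =>
    mul_nonneg (hfeas.1 i) (hfeas.2.2 i j k).1
  have hle := hmin α A (fun j k => max (S j k) 0) hfeas
  refine hle.not_gt ?_
  unfold objf
  refine add_lt_add_left (Finset.sum_lt_sum_of_nonempty ⟨⟨0, hv⟩, Finset.mem_univ _⟩ fun i _ =>
    mul_lt_mul_of_pos_left ?_ (hlam i)) _
  have hentry : ∀ j k, (α i * A i j k - max (S j k) 0) ^ 2 ≤ (α i * A i j k - S j k) ^ 2 :=
    fun j k => sq_sub_max_zero_le (ha i j k) (S j k)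
  exact Finset.sum_lt_sum (fun j _ => Finset.sum_le_sum fun k _ => hentry j k)
    ⟨j₀, Finset.mem_univ _, Finset.sum_lt_sum (fun k _ => hentry j₀ k)
      ⟨k₀, Finset.mem_univ _, sq_sub_max_zero_lt (ha i j₀ k₀) hneg⟩⟩
end

section
/- The infimum of the objective f over the feasible set G equals the infimum of f over the smaller set G₊ (where additionally S ≥ 0 entrywise). -/
/-- Replacing `S` by its entrywise positive part does not increase the objective when the scaled
view matrices are entrywise nonnegative. -/
theorem objf_posPart_le {n v : ℕ} (W : Fin v → Matrix (Fin n) (Fin n) ℝ)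
    {lam : Fin v → ℝ} (hlam : ∀ i, 0 ≤ lam i) (β γ : ℝ) {α : Fin v → ℝ}
    {A : Fin v → Matrix (Fin n) (Fin n) ℝ} (hA : ∀ i j k, 0 ≤ α i * A i j k)
    (S : Matrix (Fin n) (Fin n) ℝ) :
    objf n v W lam β γ α A (fun j k => max (S j k) 0) ≤ objf n v W lam β γ α A S := by
  have key : ∀ a s : ℝ, 0 ≤ a → (a - max s 0) ^ 2 ≤ (a - s) ^ 2 := by
    intro a s ha
    rcases le_total 0 s with hs | hs
    · rw [max_eq_left hs]
    · rw [max_eq_right hs]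
      exact pow_le_pow_left₀ (by linarith) (by linarith) 2
  unfold objf
  refine add_le_add (Finset.sum_le_sum fun i _ => ?_) le_rfl
  exact mul_le_mul_of_nonneg_left
    (Finset.sum_le_sum fun j _ => Finset.sum_le_sum fun k _ => key _ _ (hA i j k)) (hlam i)

/-- The infimum of `f` over the feasible set `G` equals the infimum of `f`
over the smaller set `G₊` where additionally `S ≥ 0` entrywise. -/
theorem inf_over_G_eq_inf_over_Gplus (n v : ℕ) (hn : 0 < n) (hv : 0 < v)
    (W : Fin v → Matrix (Fin n) (Fin n) ℝ) (hW : ∀ i j k, 0 ≤ W i j k)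
    (lam : Fin v → ℝ) (hlam : ∀ i, 0 < lam i) (β γ : ℝ) :
    sInf {y : ℝ | ∃ (α : Fin v → ℝ) (A : Fin v → Matrix (Fin n) (Fin n) ℝ)
        (S : Matrix (Fin n) (Fin n) ℝ), feasible n v W α A ∧
        y = objf n v W lam β γ α A S}
      = sInf {y : ℝ | ∃ (α : Fin v → ℝ) (A : Fin v → Matrix (Fin n) (Fin n) ℝ)
        (S : Matrix (Fin n) (Fin n) ℝ), feasible n v W α A ∧ (∀ j k, 0 ≤ S j k) ∧
        y = objf n v W lam β γ α A S} := by
  apply csInf_eq_csInf_of_forall_exists_le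
  · rintro _ ⟨α, A, S, hf, rfl⟩
    exact ⟨_, ⟨α, A, fun j k => max (S j k) 0, hf, fun j k => le_max_right _ _, rfl⟩,
      objf_posPart_le W (fun i => (hlam i).le) β γ
        (fun i j k => mul_nonneg (hf.1 i) (hf.2.2 i j k).1) S⟩
  · rintro _ ⟨α, A, S, hf, -, rfl⟩
    exact ⟨_, ⟨α, A, S, hf, rfl⟩, le_rfl⟩
end

section
/- If λ_i > 0 for all i and each W⁽ⁱ⁾ ≥ 0 entrywise, then the objective f attains its global minimum on the feasible set G; that is, there exists a point x* ∈ G with f(x*) ≤ f(x) for all x ∈ G. -/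
/-- The weighted mean minimizes the weighted sum of squared deviations. -/
theorem sum_mul_sub_weighted_mean_sq_le {ι : Type*} [Fintype ι] (w x : ι → ℝ)
    (hw : 0 < ∑ i, w i) (s : ℝ) :
    ∑ i, w i * (x i - (∑ i, w i * x i) / ∑ i, w i) ^ 2 ≤ ∑ i, w i * (x i - s) ^ 2 := by
  have expand (t : ℝ) : ∑ i, w i * (x i - t) ^ 2
      = ∑ i, w i * x i ^ 2 - 2 * t * ∑ i, w i * x i + t ^ 2 * ∑ i, w i := by
    rw [Finset.mul_sum, Finset.mul_sum, ← Finset.sum_sub_distrib, ← Finset.sum_add_distrib]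
    exact Finset.sum_congr rfl fun i _ => by ring
  rw [expand, expand]
  set m := (∑ i, w i * x i) / ∑ i, w i with hm
  have hsum : ∑ i, w i * x i = m * ∑ i, w i := by rw [hm]; field_simp
  rw [hsum]
  nlinarith [mul_nonneg hw.le (sq_nonneg (m - s))]

/-- The minimizer of `objf` in `S` for fixed `α` and `A`: the `lam`-weighted mean of the
matrices `α i • A i`. -/
noncomputable def weightedMean {n v : ℕ} (lam α : Fin v → ℝ)
    (A : Fin v → Matrix (Fin n) (Fin n) ℝ) : Matrix (Fin n) (Fin n) ℝ :=
  fun j k => (∑ i, lam i * (α i * A i j k)) / ∑ i, lam i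

theorem objf_weightedMean_le {n v : ℕ} (W : Fin v → Matrix (Fin n) (Fin n) ℝ)
    (lam : Fin v → ℝ) (hlam : 0 < ∑ i, lam i) (β γ : ℝ) (α : Fin v → ℝ)
    (A : Fin v → Matrix (Fin n) (Fin n) ℝ) (S : Matrix (Fin n) (Fin n) ℝ) :
    objf n v W lam β γ α A (weightedMean lam α A) ≤ objf n v W lam β γ α A S := by
  have swap (T : Matrix (Fin n) (Fin n) ℝ) :
      ∑ i, lam i * ∑ j, ∑ k, (α i * A i j k - T j k) ^ 2
        = ∑ j, ∑ k, ∑ i, lam i * (α i * A i j k - T j k) ^ 2 := by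
    simp_rw [Finset.mul_sum]
    rw [Finset.sum_comm]
    exact Finset.sum_congr rfl fun j _ => Finset.sum_comm
  unfold objf
  rw [swap, swap]
  gcongr ?_ + _
  exact Finset.sum_le_sum fun j _ => Finset.sum_le_sum fun k _ =>
    sum_mul_sub_weighted_mean_sq_le lam (fun i => α i * A i j k) hlam (S j k)

theorem continuous_objf_weightedMean {n v : ℕ} (W : Fin v → Matrix (Fin n) (Fin n) ℝ)
    (lam : Fin v → ℝ) (β γ : ℝ) :
    Continuous fun p : (Fin v → ℝ) × (Fin v → Fin n → Fin n → ℝ) =>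
      objf n v W lam β γ p.1 p.2 (weightedMean lam p.1 p.2) := by
  unfold objf weightedMean
  simp only [div_eq_mul_inv]
  fun_prop

/-- If `λᵢ > 0` and the `W⁽ⁱ⁾` are entrywise nonnegative, then `f` attains
its global minimum on the feasible set `G`. -/
theorem objf_attains_min_on_feasible (n v : ℕ) (hn : 0 < n) (hv : 0 < v)
    (W : Fin v → Matrix (Fin n) (Fin n) ℝ) (hW : ∀ i j k, 0 ≤ W i j k)
    (lam : Fin v → ℝ) (hlam : ∀ i, 0 < lam i) (β γ : ℝ) :
    ∃ (α : Fin v → ℝ) (A : Fin v → Matrix (Fin n) (Fin n) ℝ)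
      (S : Matrix (Fin n) (Fin n) ℝ), feasible n v W α A ∧
      ∀ (α' : Fin v → ℝ) (A' : Fin v → Matrix (Fin n) (Fin n) ℝ)
        (S' : Matrix (Fin n) (Fin n) ℝ), feasible n v W α' A' →
        objf n v W lam β γ α A S ≤ objf n v W lam β γ α' A' S' := by
  have : Nonempty (Fin v) := ⟨⟨0, hv⟩⟩
  have hsum : 0 < ∑ i, lam i :=
    Finset.sum_pos (fun i _ => hlam i) Finset.univ_nonempty
  let W' : Fin v → Fin n → Fin n → ℝ := W
  have hcompact : IsCompact (stdSimplex ℝ (Fin v) ×ˢ Set.Icc 0 W') :=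
    (isCompact_stdSimplex ℝ (Fin v)).prod isCompact_Icc
  have hne : (stdSimplex ℝ (Fin v) ×ˢ Set.Icc 0 W').Nonempty :=
    ⟨(Pi.single ⟨0, hv⟩ 1, 0), single_mem_stdSimplex ℝ _, le_rfl, hW⟩
  obtain ⟨⟨α, A⟩, ⟨hα, hA⟩, hmin⟩ :=
    hcompact.exists_isMinOn hne (continuous_objf_weightedMean W lam β γ).continuousOn
  refine ⟨α, A, weightedMean lam α A,
    ⟨hα.1, hα.2, fun i j k => ⟨hA.1 i j k, hA.2 i j k⟩⟩, fun α' A' S' h => ?_⟩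
  have hmem : ((α', A') : (Fin v → ℝ) × (Fin v → Fin n → Fin n → ℝ)) ∈
      stdSimplex ℝ (Fin v) ×ˢ Set.Icc 0 W' :=
    ⟨⟨h.1, h.2.1⟩, fun i j k => (h.2.2 i j k).1, fun i j k => (h.2.2 i j k).2⟩
  exact (hmin hmem).trans (objf_weightedMean_le W lam hsum β γ α' A' S')
end
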